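/- Let N be a positive natural number, let α < 0 and β be real numbers, and suppose M := −β/(2α) is a natural number with 0 ≤ M ≤ N. Then a binary vector x ∈ {0,1}^N maximizes xᵀ (α J_N + β I_N) x over all binary vectors in {0,1}^N if and only if ∑_i x_i = M, and the maximum value equals α M² + β M = −β²/(4α). -/

import Mathlib

open Matrix

/-- On binary vectors the quadratic form of `α J + β I` depends only on the coordinate sum. -/
theorem dotProduct_smul_ones_add_smul_one_mulVec_of_binary {ι : Type*} [Fintype ι] [DecidableEq ι]
    (α β : ℝ) (y : ι → ℝ) (hy : ∀ i, y i = 0 ∨ y i = 1) :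
    y ⬝ᵥ (α • (Matrix.of fun _ _ : ι => (1 : ℝ)) + β • (1 : Matrix ι ι ℝ)).mulVec y
      = α * (∑ i, y i) ^ 2 + β * ∑ i, y i := by
  have hsq : y ⬝ᵥ y = ∑ i, y i :=
    Finset.sum_congr rfl fun i _ => by rcases hy i with h | h <;> simp [h]
  have hones : (Matrix.of fun _ _ : ι => (1 : ℝ)).mulVec y = fun _ => ∑ i, y i := by
    ext i
    simp [Matrix.mulVec, dotProduct]
  have hdot : y ⬝ᵥ (fun _ => ∑ i, y i) = (∑ i, y i) ^ 2 := by
    rw [dotProduct, ← Finset.sum_mul, sq]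
  rw [Matrix.add_mulVec, Matrix.smul_mulVec, Matrix.smul_mulVec, Matrix.one_mulVec,
    dotProduct_add, dotProduct_smul, dotProduct_smul, hones, hdot, hsq, smul_eq_mul, smul_eq_mul]

theorem exists_binary_sum_eq {N M : ℕ} (hMN : M ≤ N) :
    ∃ y : Fin N → ℝ, (∀ i, y i = 0 ∨ y i = 1) ∧ ∑ i, y i = (M : ℝ) := by
  refine ⟨fun i => if (i : ℕ) < M then 1 else 0, fun i => ?_, ?_⟩
  · by_cases h : (i : ℕ) < M <;> simp [h]
  · rw [Finset.sum_boole, Fin.card_filter_val_lt, min_eq_right hMN]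

theorem qubo_constraint_max_iff (N : ℕ) (hN : 0 < N) (α β : ℝ) (hα : α < 0)
    (M : ℕ) (hM : (M : ℝ) = -β / (2 * α)) (hMN : M ≤ N)
    (x : Fin N → ℝ) (hx : ∀ i, x i = 0 ∨ x i = 1) :
    ((∀ y : Fin N → ℝ, (∀ i, y i = 0 ∨ y i = 1) →
        x ⬝ᵥ (α • (Matrix.of fun _ _ : Fin N => (1 : ℝ))
              + β • (1 : Matrix (Fin N) (Fin N) ℝ)).mulVec x
          ≥ y ⬝ᵥ (α • (Matrix.of fun _ _ : Fin N => (1 : ℝ))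
              + β • (1 : Matrix (Fin N) (Fin N) ℝ)).mulVec y)
      ↔ ∑ i, x i = (M : ℝ))
    ∧ (∑ i, x i = (M : ℝ) →
        x ⬝ᵥ (α • (Matrix.of fun _ _ : Fin N => (1 : ℝ))
              + β • (1 : Matrix (Fin N) (Fin N) ℝ)).mulVec x
          = α * (M : ℝ) ^ 2 + β * (M : ℝ))
    ∧ α * (M : ℝ) ^ 2 + β * (M : ℝ) = -β ^ 2 / (4 * α) := by
  have hα' : α ≠ 0 := hα.ne
  have hβ : β = -2 * α * M := by
    rw [hM]
    field_simp
  have hform := dotProduct_smul_ones_add_smul_one_mulVec_of_binary (ι := Fin N) α β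
  refine ⟨⟨fun h => ?_, fun h y hy => ?_⟩, fun h => ?_, ?_⟩
  · obtain ⟨y, hy, hsum⟩ := exists_binary_sum_eq hMN
    have hle := h y hy
    rw [hform x hx, hform y hy, hsum, hβ] at hle
    have hsq : (∑ i, x i - (M : ℝ)) ^ 2 ≤ 0 := by
      by_contra! hpos
      nlinarith [mul_neg_of_neg_of_pos hα hpos]
    exact sub_eq_zero.mp (pow_eq_zero_iff two_ne_zero |>.mp (hsq.antisymm (sq_nonneg _)))
  · rw [hform x hx, hform y hy, h, hβ]
    nlinarith [mul_nonpos_of_nonpos_of_nonneg hα.le (sq_nonneg (∑ i, y i - (M : ℝ)))]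
  · rw [hform x hx, h]
  · rw [hβ]
    field_simp
    ring
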